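/- arXiv:1612.01819 — 2 statements merged into one kernel-verified Lean document; each statement's English description precedes it below -/
import Mathlib

section
/- Let a ≥ b > 0 and r ≥ 0. The area of the Minkowski sum K(a,b) + closedBall(0,r) (the outer parallel body of the elliptical region at distance r) equals πr² + πab + 4raE(ε), where ε = √(a²−b²)/a and E(ε) = ∫₀^{π/2} √(1−ε² sin²θ) dθ. -/
open Real MeasureTheory Set Metric

noncomputable section

/-- The Euclidean plane. -/
abbrev E2 := EuclideanSpace ℝ (Fin 2)

/-- Closed elliptical region with semi-axes `a`, `b`. -/
def Kset (a b : ℝ) : Set E2 := {x | (x 0)^2 / a^2 + (x 1)^2 / b^2 ≤ 1}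

/-- The ellipse with semi-axes `a`, `b`. -/
def Cset (a b : ℝ) : Set E2 := {x | (x 0)^2 / a^2 + (x 1)^2 / b^2 = 1}

/-- Incomplete elliptic integral of the second kind `E(φ, ε)`. -/
def Einc (ε φ : ℝ) : ℝ := ∫ θ in (0:ℝ)..φ, Real.sqrt (1 - ε^2 * Real.sin θ^2)

/-- Complete elliptic integral of the second kind `E(ε)`. -/
def Ecomp (ε : ℝ) : ℝ := Einc ε (π/2)

/-- Eccentricity of the ellipse with semi-axes `a ≥ b`. -/
def ecc (a b : ℝ) : ℝ := Real.sqrt (a^2 - b^2) / a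

/-- The support function of `Kset a b`. -/
def ellipseSupport (a b : ℝ) (p : ℝ × ℝ) : ℝ := √(a ^ 2 * p.1 ^ 2 + b ^ 2 * p.2 ^ 2)

/-- The map `z ↦ z + ∇h(z)`, where `h` is the support function of `Kset a b`. -/
def addSupportGradient (a b : ℝ) (p : ℝ × ℝ) : ℝ × ℝ :=
  (p.1 + a ^ 2 * p.1 / ellipseSupport a b p, p.2 + b ^ 2 * p.2 / ellipseSupport a b p)

lemma sq_ellipseSupport (a b : ℝ) (p : ℝ × ℝ) :
    ellipseSupport a b p ^ 2 = a ^ 2 * p.1 ^ 2 + b ^ 2 * p.2 ^ 2 :=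
  sq_sqrt (by positivity)

lemma ellipseSupport_pos {a b : ℝ} (ha : 0 < a) (hb : 0 < b) {p : ℝ × ℝ} (hp : p ≠ 0) :
    0 < ellipseSupport a b p := by
  refine sqrt_pos.2 ?_
  by_cases h : p.1 = 0
  · have : p.2 ≠ 0 := fun h' => hp (Prod.ext h h')
    positivity
  · positivity

/-- The derivative of `addSupportGradient a b` away from the origin. -/
def fderivAddSupportGradient (a b : ℝ) (p : ℝ × ℝ) : ℝ × ℝ →L[ℝ] ℝ × ℝ :=
  (Matrix.toLin (.finTwoProd ℝ) (.finTwoProd ℝ)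
    !![1 + a ^ 2 * b ^ 2 * p.2 ^ 2 / ellipseSupport a b p ^ 3,
        -(a ^ 2 * b ^ 2 * p.1 * p.2 / ellipseSupport a b p ^ 3);
      -(a ^ 2 * b ^ 2 * p.1 * p.2 / ellipseSupport a b p ^ 3),
        1 + a ^ 2 * b ^ 2 * p.1 ^ 2 / ellipseSupport a b p ^ 3]).toContinuousLinearMap

lemma det_fderivAddSupportGradient (a b : ℝ) (p : ℝ × ℝ) :
    (fderivAddSupportGradient a b p).det =
      1 + a ^ 2 * b ^ 2 * (p.1 ^ 2 + p.2 ^ 2) / ellipseSupport a b p ^ 3 := by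
  unfold fderivAddSupportGradient
  simp only [LinearMap.det_toContinuousLinearMap, LinearMap.det_toLin, Matrix.det_fin_two_of]
  ring

lemma hasFDerivAt_addSupportGradient {a b : ℝ} (ha : 0 < a) (hb : 0 < b) {p : ℝ × ℝ}
    (hp : p ≠ 0) :
    HasFDerivAt (addSupportGradient a b) (fderivAddSupportGradient a b p) p := by
  have hpos := ellipseSupport_pos ha hb hp
  have hsq := sq_ellipseSupport a b p
  have hfst : HasFDerivAt (fun q : ℝ × ℝ => q.1) (ContinuousLinearMap.fst ℝ ℝ ℝ) p :=
    hasFDerivAt_fst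
  have hsnd : HasFDerivAt (fun q : ℝ × ℝ => q.2) (ContinuousLinearMap.snd ℝ ℝ ℝ) p :=
    hasFDerivAt_snd
  have hS := (((hfst.pow 2).const_mul (a ^ 2)).fun_add ((hsnd.pow 2).const_mul (b ^ 2))).sqrt
    (by rw [← hsq]; positivity)
  have hinv := (hasDerivAt_inv hpos.ne').comp_hasFDerivAt p hS
  have h1 := hfst.add ((hfst.const_mul (a ^ 2)).mul hinv)
  have h2 := hsnd.add ((hsnd.const_mul (b ^ 2)).mul hinv)
  have key := h1.prodMk h2
  unfold fderivAddSupportGradient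
  rw [Matrix.toLin_finTwoProd_toContinuousLinearMap]
  refine key.congr_fderiv ?_
  have e : √(a ^ 2 * p.1 ^ 2 + b ^ 2 * p.2 ^ 2) = ellipseSupport a b p := rfl
  ext <;> simp [e] <;> field_simp <;> simp only [hsq] <;> ring

lemma inner_le_ellipseSupport {a b : ℝ} (ha : 0 < a) (hb : 0 < b) {x y : ℝ}
    (h : x ^ 2 / a ^ 2 + y ^ 2 / b ^ 2 ≤ 1) (p : ℝ × ℝ) :
    x * p.1 + y * p.2 ≤ ellipseSupport a b p := by
  refine le_sqrt_of_sq_le ?_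
  have h1 : (x * p.1 + y * p.2) ^ 2 ≤
      (x ^ 2 / a ^ 2 + y ^ 2 / b ^ 2) * (a ^ 2 * p.1 ^ 2 + b ^ 2 * p.2 ^ 2) := by
    have : (x ^ 2 / a ^ 2 + y ^ 2 / b ^ 2) * (a ^ 2 * p.1 ^ 2 + b ^ 2 * p.2 ^ 2) -
      (x * p.1 + y * p.2) ^ 2 = (x * b * p.2 / a - y * a * p.1 / b) ^ 2 := by
      field_simp
      ring
    nlinarith [sq_nonneg (x * b * p.2 / a - y * a * p.1 / b)]
  nlinarith [mul_le_mul_of_nonneg_right h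
    (show 0 ≤ a ^ 2 * p.1 ^ 2 + b ^ 2 * p.2 ^ 2 by positivity)]

lemma eq_supportGradient_of_le_inner {a b : ℝ} (ha : 0 < a) (hb : 0 < b) {x y : ℝ}
    (h : x ^ 2 / a ^ 2 + y ^ 2 / b ^ 2 ≤ 1) {p : ℝ × ℝ} (hp : p ≠ 0)
    (hle : ellipseSupport a b p ≤ x * p.1 + y * p.2) :
    x = a ^ 2 * p.1 / ellipseSupport a b p ∧ y = b ^ 2 * p.2 / ellipseSupport a b p := by
  have hpos := ellipseSupport_pos ha hb hp
  have hsq := sq_ellipseSupport a b p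
  set s := ellipseSupport a b p
  have hsum : (x / a - a * p.1 / s) ^ 2 + (y / b - b * p.2 / s) ^ 2 ≤ 0 := by
    have e : (x / a - a * p.1 / s) ^ 2 + (y / b - b * p.2 / s) ^ 2 =
        (x ^ 2 / a ^ 2 + y ^ 2 / b ^ 2) + (a ^ 2 * p.1 ^ 2 + b ^ 2 * p.2 ^ 2) / s ^ 2 -
          2 * ((x * p.1 + y * p.2) / s) := by
      field_simp
      ring
    have h2 : 1 ≤ (x * p.1 + y * p.2) / s := (one_le_div hpos).2 hle
    rw [e, ← hsq, div_self (by positivity)]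
    linarith
  have hx : x / a - a * p.1 / s = 0 := by
    nlinarith [sq_nonneg (x / a - a * p.1 / s), sq_nonneg (y / b - b * p.2 / s)]
  have hy : y / b - b * p.2 / s = 0 := by
    nlinarith [sq_nonneg (x / a - a * p.1 / s), sq_nonneg (y / b - b * p.2 / s)]
  constructor
  · field_simp at hx ⊢
    linarith
  · field_simp at hy ⊢
    linarith

lemma supportGradient_mem {a b : ℝ} (ha : 0 < a) (hb : 0 < b) {p : ℝ × ℝ} (hp : p ≠ 0) :
    (a ^ 2 * p.1 / ellipseSupport a b p) ^ 2 / a ^ 2 +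
      (b ^ 2 * p.2 / ellipseSupport a b p) ^ 2 / b ^ 2 ≤ 1 := by
  have hpos := ellipseSupport_pos ha hb hp
  have hsq := sq_ellipseSupport a b p
  field_simp
  linarith

lemma inner_supportGradient_self {a b : ℝ} (ha : 0 < a) (hb : 0 < b) {p : ℝ × ℝ} (hp : p ≠ 0) :
    a ^ 2 * p.1 / ellipseSupport a b p * p.1 + b ^ 2 * p.2 / ellipseSupport a b p * p.2 =
      ellipseSupport a b p := by
  have hpos := ellipseSupport_pos ha hb hp
  have hsq := sq_ellipseSupport a b p
  field_simp
  linarith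

lemma injOn_addSupportGradient {a b : ℝ} (ha : 0 < a) (hb : 0 < b) :
    InjOn (addSupportGradient a b) {0}ᶜ := by
  intro p hp q hq hpq
  have h1 := congrArg Prod.fst hpq
  have h2 := congrArg Prod.snd hpq
  simp only [addSupportGradient] at h1 h2
  have hpp := inner_supportGradient_self ha hb hp
  have hqq := inner_supportGradient_self ha hb hq
  have hpq := inner_le_ellipseSupport ha hb (supportGradient_mem ha hb hp) q
  have hqp := inner_le_ellipseSupport ha hb (supportGradient_mem ha hb hq) p
  set x := a ^ 2 * p.1 / ellipseSupport a b p
  set y := b ^ 2 * p.2 / ellipseSupport a b p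
  set x' := a ^ 2 * q.1 / ellipseSupport a b q
  set y' := b ^ 2 * q.2 / ellipseSupport a b q
  have e1 : x' = x + (p.1 - q.1) := by linarith
  have e2 : y' = y + (p.2 - q.2) := by linarith
  rw [e1, e2] at hqp hqq
  have h : (p.1 - q.1) ^ 2 + (p.2 - q.2) ^ 2 ≤ 0 := by linarith
  ext
  · nlinarith [sq_nonneg (p.1 - q.1), sq_nonneg (p.2 - q.2)]
  · nlinarith [sq_nonneg (p.1 - q.1), sq_nonneg (p.2 - q.2)]

lemma mem_closedBall_zero_iff_sq {r : ℝ} (hr : 0 ≤ r) (x : E2) :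
    x ∈ closedBall (0 : E2) r ↔ x 0 ^ 2 + x 1 ^ 2 ≤ r ^ 2 := by
  rw [mem_closedBall_zero_iff, EuclideanSpace.norm_eq, sqrt_le_left hr]
  simp [Fin.sum_univ_two]

lemma Kset_eq_preimage (a b : ℝ) :
    Kset a b = Matrix.toEuclideanLin !![a⁻¹, 0; 0, b⁻¹] ⁻¹' closedBall (0 : E2) 1 := by
  ext x
  rw [mem_preimage, mem_closedBall_zero_iff_sq zero_le_one]
  simp [Kset, Matrix.toLpLin_apply, dotProduct, mul_pow, div_eq_inv_mul]

lemma volume_Kset {a b : ℝ} (ha : 0 < a) (hb : 0 < b) :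
    volume (Kset a b) = ENNReal.ofReal (π * a * b) := by
  have hdet : LinearMap.det (Matrix.toEuclideanLin !![a⁻¹, 0; 0, b⁻¹]) = a⁻¹ * b⁻¹ := by
    simp [LinearMap.det_toLpLin, Matrix.det_fin_two_of]
  rw [Kset_eq_preimage, Measure.addHaar_preimage_linearMap _ (by rw [hdet]; positivity), hdet,
    EuclideanSpace.volume_closedBall_fin_two, abs_of_pos (by positivity)]
  simp only [ENNReal.ofReal_one, one_pow, one_mul]
  rw [← ENNReal.ofReal_mul (by positivity)]
  congr 1
  field_simp

lemma convex_Kset (a b : ℝ) : Convex ℝ (Kset a b) := by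
  rw [Kset_eq_preimage]
  exact (convex_closedBall _ _).linear_preimage _

lemma isClosed_Kset (a b : ℝ) : IsClosed (Kset a b) := by
  rw [Kset_eq_preimage]
  exact isClosed_closedBall.preimage (LinearMap.continuous_of_finiteDimensional _)

lemma exists_nearest_Kset (a b : ℝ) (x : E2) :
    ∃ p ∈ Kset a b, (∀ w ∈ Kset a b, ‖x - p‖ ≤ ‖x - w‖) ∧
      ∀ w ∈ Kset a b, (x 0 - p 0) * (w 0 - p 0) + (x 1 - p 1) * (w 1 - p 1) ≤ 0 := by
  have hne : (Kset a b).Nonempty := ⟨0, by simp [Kset]⟩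
  obtain ⟨p, hp, hmin⟩ := exists_norm_eq_iInf_of_complete_convex hne
    (isClosed_Kset a b).isComplete (convex_Kset a b) x
  refine ⟨p, hp, fun w hw => ?_, fun w hw => ?_⟩
  · rw [hmin]
    exact ciInf_le ⟨0, Set.forall_mem_range.2 fun _ => norm_nonneg _⟩ (⟨w, hw⟩ : Kset a b)
  · have := (norm_eq_iInf_iff_real_inner_le_zero (convex_Kset a b) hp).1 hmin w hw
    simp only [PiLp.inner_apply, Fin.sum_univ_two, PiLp.sub_apply, RCLike.inner_apply,
      conj_trivial] at this
    linarith

open Pointwise in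
lemma parallel_diff_Kset_eq {a b r : ℝ} (ha : 0 < a) (hb : 0 < b) (hr : 0 ≤ r) :
    (Kset a b + closedBall (0 : E2) r) \ Kset a b =
      (fun x : E2 => (x 0, x 1)) ⁻¹'
        (addSupportGradient a b '' {p | p ≠ 0 ∧ p.1 ^ 2 + p.2 ^ 2 ≤ r ^ 2}) := by
  ext x
  constructor
  · rintro ⟨⟨k, hk, z, hz, rfl⟩, hx⟩
    obtain ⟨p, hp, hmin, hinner⟩ := exists_nearest_Kset a b (k + z)
    set x := k + z with hxdef
    have hne : (x 0 - p 0, x 1 - p 1) ≠ (0 : ℝ × ℝ) := by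
      intro h
      have h0 := congrArg Prod.fst h
      have h1 := congrArg Prod.snd h
      refine hx ?_
      have : x = p := by
        ext i
        fin_cases i
        · exact sub_eq_zero.1 h0
        · exact sub_eq_zero.1 h1
      change x ∈ Kset a b
      rwa [this]
    have hmem := supportGradient_mem ha hb hne
    have hself := inner_supportGradient_self ha hb hne
    have hle := hinner !₂[_, _] hmem
    obtain ⟨e0, e1⟩ := eq_supportGradient_of_le_inner ha hb hp hne (by
      simp at hle hself ⊢
      linarith)
    refine ⟨_, ⟨hne, ?_⟩, ?_⟩
    · have hd : x - p ∈ closedBall (0 : E2) r := by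
        rw [mem_closedBall_zero_iff] at hz ⊢
        refine (hmin k hk).trans ?_
        simpa [hxdef] using hz
      simpa using (mem_closedBall_zero_iff_sq hr _).1 hd
    · simp only [addSupportGradient, ← e0, ← e1]
      simp [x]
  · rintro ⟨p, ⟨hp, hpr⟩, hpx⟩
    have h0 : _ = x 0 := congrArg Prod.fst hpx
    have h1 : _ = x 1 := congrArg Prod.snd hpx
    simp only [addSupportGradient] at h0 h1
    have hmem := supportGradient_mem ha hb hp
    constructor
    · refine ⟨!₂[_, _], hmem, !₂[p.1, p.2], ?_, ?_⟩
      · rw [mem_closedBall_zero_iff_sq hr]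
        simpa using hpr
      · ext i
        fin_cases i
        · simp [← h0, add_comm]
        · simp [← h1, add_comm]
    · intro hx
      have hle := inner_le_ellipseSupport ha hb hx p
      have hself := inner_supportGradient_self ha hb hp
      rw [← h0, ← h1] at hle
      have : p.1 ^ 2 + p.2 ^ 2 ≤ 0 := by linarith
      refine hp (Prod.ext ?_ ?_)
      · change p.1 = 0
        nlinarith [sq_nonneg p.1, sq_nonneg p.2]
      · change p.2 = 0
        nlinarith [sq_nonneg p.1, sq_nonneg p.2]

lemma measurePreserving_coords :
    MeasurePreserving (fun x : E2 => (x 0, x 1)) volume volume :=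
  (volume_preserving_finTwoArrow ℝ).comp (PiLp.volume_preserving_ofLp (Fin 2))

/-- The radius of curvature of the ellipse at the boundary point with outer normal angle `θ`. -/
def curvatureRadius (a b θ : ℝ) : ℝ :=
  a ^ 2 * b ^ 2 / ellipseSupport a b (cos θ, sin θ) ^ 3

lemma cos_sin_ne_zero (θ : ℝ) : (cos θ, sin θ) ≠ (0 : ℝ × ℝ) := by
  intro h
  have h0 : cos θ = 0 := congrArg Prod.fst h
  have h1 : sin θ = 0 := congrArg Prod.snd h
  simpa [h0, h1] using sin_sq_add_cos_sq θ

open Pointwise in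
lemma volume_parallel_diff_Kset {a b r : ℝ} (ha : 0 < a) (hb : 0 < b) (hr : 0 ≤ r) :
    volume ((Kset a b + closedBall (0 : E2) r) \ Kset a b) =
      ∫⁻ q in Ioc 0 r ×ˢ Ioo (-π) π, ENNReal.ofReal (q.1 + curvatureRadius a b q.2) := by
  set s : Set (ℝ × ℝ) := {p | p ≠ 0 ∧ p.1 ^ 2 + p.2 ^ 2 ≤ r ^ 2}
  have hs : MeasurableSet s :=
    (measurableSet_singleton 0).compl.inter
      (isClosed_le (f := fun p : ℝ × ℝ => p.1 ^ 2 + p.2 ^ 2) (by fun_prop)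
        continuous_const).measurableSet
  have hderiv : ∀ p ∈ s, HasFDerivWithinAt (addSupportGradient a b)
      (fderivAddSupportGradient a b p) s p := fun p hp =>
    (hasFDerivAt_addSupportGradient ha hb hp.1).hasFDerivWithinAt
  have hinj : InjOn (addSupportGradient a b) s :=
    (injOn_addSupportGradient ha hb).mono fun p hp => hp.1
  have himage : MeasurableSet (addSupportGradient a b '' s) :=
    measurable_image_of_fderivWithin hs hderiv hinj
  rw [parallel_diff_Kset_eq ha hb hr,
    measurePreserving_coords.measure_preimage himage.nullMeasurableSet,
    ← lintegral_abs_det_fderiv_eq_addHaar_image volume hs hderiv hinj, ← lintegral_indicator hs,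
    ← lintegral_comp_polarCoord_symm]
  have hsub : Ioc 0 r ×ˢ Ioo (-π) π ⊆ polarCoord.target := fun q hq => ⟨hq.1.1, hq.2⟩
  rw [← inter_eq_self_of_subset_left hsub,
    ← setLIntegral_indicator (measurableSet_Ioc.prod measurableSet_Ioo)]
  refine setLIntegral_congr_fun polarCoord.open_target.measurableSet fun q hq => ?_
  obtain ⟨t, θ⟩ := q
  obtain ⟨ht, hθ⟩ := hq
  have ht : 0 < t := ht
  have hnorm : (t * cos θ) ^ 2 + (t * sin θ) ^ 2 = t ^ 2 := by
    linear_combination t ^ 2 * sin_sq_add_cos_sq θ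
  have hmem : polarCoord.symm (t, θ) ∈ s ↔ (t, θ) ∈ Ioc 0 r ×ˢ Ioo (-π) π := by
    have hne : polarCoord.symm (t, θ) ≠ 0 := by
      intro h
      have h0 : t * cos θ = 0 := congrArg Prod.fst h
      have h1 : t * sin θ = 0 := congrArg Prod.snd h
      rw [h0, h1] at hnorm
      nlinarith
    have : polarCoord.symm (t, θ) ∈ s ↔ t ^ 2 ≤ r ^ 2 := by
      rw [← hnorm]
      exact and_iff_right hne
    rw [this, sq_le_sq₀ ht.le hr]
    exact ⟨fun h => ⟨⟨ht, h⟩, hθ⟩, fun h => h.1.2⟩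
  by_cases h : (t, θ) ∈ Ioc 0 r ×ˢ Ioo (-π) π
  · rw [indicator_of_mem h, indicator_of_mem (hmem.2 h), det_fderivAddSupportGradient, smul_eq_mul,
      ← ENNReal.ofReal_mul ht.le]
    have hsupp : ellipseSupport a b (polarCoord.symm (t, θ)) =
        t * ellipseSupport a b (cos θ, sin θ) := by
      rw [ellipseSupport, ellipseSupport, ← sqrt_sq ht.le, ← sqrt_mul (by positivity),
        sqrt_sq ht.le]
      congr 1
      simp only [polarCoord_symm_apply]
      ring
    have hpos := ellipseSupport_pos ha hb (cos_sin_ne_zero θ)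
    rw [hsupp]
    simp only [polarCoord_symm_apply, hnorm, curvatureRadius]
    rw [abs_of_pos (by positivity)]
    congr 1
    field_simp
  · rw [indicator_of_notMem h, indicator_of_notMem (mt hmem.1 h), smul_zero]

lemma ellipseSupport_cos_sin {a b : ℝ} (hb : 0 < b) (hab : b ≤ a) (θ : ℝ) :
    ellipseSupport a b (cos θ, sin θ) = a * √(1 - ecc a b ^ 2 * sin θ ^ 2) := by
  have ha : 0 < a := hb.trans_le hab
  rw [ellipseSupport, ← sqrt_sq ha.le, ← sqrt_mul (by positivity), sqrt_sq ha.le, ecc, div_pow,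
    sq_sqrt (by nlinarith)]
  congr 1
  simp only
  field_simp
  linear_combination a ^ 2 * sin_sq_add_cos_sq θ

lemma continuous_ellipseSupport_cos_sin (a b : ℝ) :
    Continuous fun θ : ℝ => ellipseSupport a b (cos θ, sin θ) := by
  unfold ellipseSupport
  fun_prop

lemma continuous_curvatureRadius {a b : ℝ} (ha : 0 < a) (hb : 0 < b) :
    Continuous (curvatureRadius a b) :=
  continuous_const.div ((continuous_ellipseSupport_cos_sin a b).pow 3) fun θ =>
    (pow_pos (ellipseSupport_pos ha hb (cos_sin_ne_zero θ)) 3).ne'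

/-- The function integrated here is even and has period `π`. -/
lemma integral_sqrt_one_sub_sq_mul_sin_sq (ε : ℝ) :
    ∫ θ in (-π)..π, √(1 - ε ^ 2 * sin θ ^ 2) = 4 * Ecomp ε := by
  set f : ℝ → ℝ := fun θ => √(1 - ε ^ 2 * sin θ ^ 2)
  have hf : Continuous f := by fun_prop
  have hi : ∀ u v, IntervalIntegrable f volume u v := fun u v => hf.intervalIntegrable u v
  have h1 : ∫ θ in (-π)..0, f θ = ∫ θ in (0 : ℝ)..π, f θ := by
    have := intervalIntegral.integral_comp_neg (a := 0) (b := π) f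
    simp only [neg_zero] at this
    rw [← this]
    simp [f]
  have h2 : ∫ θ in (π / 2)..π, f θ = ∫ θ in (0 : ℝ)..(π / 2), f θ := by
    have := intervalIntegral.integral_comp_sub_left (a := 0) (b := π / 2) f π
    rw [sub_zero, sub_half] at this
    rw [← this]
    simp [f]
  rw [← intervalIntegral.integral_add_adjacent_intervals (hi (-π) 0) (hi 0 π), h1,
    ← intervalIntegral.integral_add_adjacent_intervals (hi 0 (π / 2)) (hi (π / 2) π), h2]
  change _ = 4 * ∫ θ in (0 : ℝ)..(π / 2), f θ
  ring

lemma integral_curvatureRadius {a b : ℝ} (hb : 0 < b) (hab : b ≤ a) :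
    ∫ θ in (-π)..π, curvatureRadius a b θ = 4 * a * Ecomp (ecc a b) := by
  have ha : 0 < a := hb.trans_le hab
  set h : ℝ → ℝ := fun θ => ellipseSupport a b (cos θ, sin θ)
  have hcont : Continuous h := continuous_ellipseSupport_cos_sin a b
  have hpos : ∀ θ, 0 < h θ := fun θ => ellipseSupport_pos ha hb (cos_sin_ne_zero θ)
  have hsq : ∀ θ, h θ ^ 2 = a ^ 2 * cos θ ^ 2 + b ^ 2 * sin θ ^ 2 := fun θ =>
    sq_ellipseSupport a b _
  have hh : ∀ θ, HasDerivAt h ((b ^ 2 - a ^ 2) * (sin θ * cos θ) / h θ) θ := fun θ => by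
    have := ((((hasDerivAt_cos θ).pow 2).const_mul (a ^ 2)).fun_add
      (((hasDerivAt_sin θ).pow 2).const_mul (b ^ 2))).sqrt (by
        have := hpos θ
        simp only [Pi.pow_apply]
        rw [← hsq]
        positivity)
    refine this.congr_deriv ?_
    have e : √(a ^ 2 * (cos ^ 2) θ + b ^ 2 * (sin ^ 2) θ) = h θ := rfl
    rw [e]
    have := hpos θ
    field_simp
    ring
  have hh' : ∀ θ, HasDerivAt (fun θ => (b ^ 2 - a ^ 2) * (sin θ * cos θ) / h θ)
      (curvatureRadius a b θ - h θ) θ := fun θ => by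
    have := (((hasDerivAt_sin θ).mul (hasDerivAt_cos θ)).const_mul (b ^ 2 - a ^ 2)).div (hh θ)
      (hpos θ).ne'
    refine this.congr_deriv ?_
    have hp := hpos θ
    have e : curvatureRadius a b θ = a ^ 2 * b ^ 2 / h θ ^ 3 := rfl
    rw [e]
    simp only [Pi.mul_apply]
    have h4 : h θ ^ 4 = (a ^ 2 * cos θ ^ 2 + b ^ 2 * sin θ ^ 2) ^ 2 := by rw [← hsq]; ring
    field_simp
    rw [h4, hsq]
    linear_combination a ^ 2 * b ^ 2 * (sin θ ^ 2 + cos θ ^ 2 + 1) * sin_sq_add_cos_sq θ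
  have hρ := continuous_curvatureRadius ha hb
  have hint := intervalIntegral.integral_eq_sub_of_hasDerivAt (a := -π) (b := π)
    (fun θ _ => hh' θ) ((hρ.sub hcont).intervalIntegrable _ _)
  rw [intervalIntegral.integral_sub (hρ.intervalIntegrable _ _) (hcont.intervalIntegrable _ _)]
    at hint
  have hperim : ∫ θ in (-π)..π, h θ = a * (4 * Ecomp (ecc a b)) := by
    rw [← integral_sqrt_one_sub_sq_mul_sin_sq, ← intervalIntegral.integral_const_mul]
    exact intervalIntegral.integral_congr fun θ _ => ellipseSupport_cos_sin hb hab θ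
  rw [hperim] at hint
  simp only [sin_neg, sin_pi, neg_zero, zero_mul, mul_zero, zero_div, sub_zero] at hint
  linarith

lemma setLIntegral_add_curvatureRadius {a b r : ℝ} (hb : 0 < b) (hab : b ≤ a) (hr : 0 ≤ r) :
    ∫⁻ q in Ioc 0 r ×ˢ Ioo (-π) π, ENNReal.ofReal (q.1 + curvatureRadius a b q.2) =
      ENNReal.ofReal (π * r ^ 2 + 4 * r * a * Ecomp (ecc a b)) := by
  have ha : 0 < a := hb.trans_le hab
  have hρ := continuous_curvatureRadius ha hb
  have hcont : Continuous fun q : ℝ × ℝ => q.1 + curvatureRadius a b q.2 := by fun_prop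
  have hint : IntegrableOn (fun q : ℝ × ℝ => q.1 + curvatureRadius a b q.2)
      (Ioc 0 r ×ˢ Ioo (-π) π) :=
    (hcont.continuousOn.integrableOn_compact (isCompact_Icc.prod isCompact_Icc)).mono_set
      (prod_mono Ioc_subset_Icc_self Ioo_subset_Icc_self)
  rw [← ofReal_integral_eq_lintegral_ofReal hint]
  · congr 1
    rw [Measure.volume_eq_prod, setIntegral_prod _ hint]
    have hinner : ∀ t : ℝ, ∫ θ in Ioo (-π) π, (t + curvatureRadius a b θ) =
        2 * π * t + 4 * a * Ecomp (ecc a b) := fun t => by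
      rw [← integral_Ioc_eq_integral_Ioo, ← intervalIntegral.integral_of_le (by linarith [pi_pos]),
        intervalIntegral.integral_add (by simp) (hρ.intervalIntegrable _ _),
        integral_curvatureRadius hb hab]
      rw [intervalIntegral.integral_const, smul_eq_mul]
      ring
    simp only [hinner]
    rw [← intervalIntegral.integral_of_le hr, intervalIntegral.integral_add
      (Continuous.intervalIntegrable (by fun_prop) _ _) (by simp),
      intervalIntegral.integral_const_mul, integral_id]
    simp
    ring
  · filter_upwards [ae_restrict_mem (measurableSet_Ioc.prod measurableSet_Ioo)] with q hq
    have := ellipseSupport_pos ha hb (cos_sin_ne_zero q.2)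
    have := hq.1.1
    simp only [Pi.zero_apply, curvatureRadius]
    positivity

open Pointwise in
/-- Steiner-type formula: the area of the outer parallel body of the elliptical region at
distance `r` is `πr² + πab + 4raE(ε)`. -/
theorem area_outer_parallel_body (a b r : ℝ) (hb : 0 < b) (hab : b ≤ a) (hr : 0 ≤ r) :
    volume (Kset a b + closedBall (0:E2) r) =
      ENNReal.ofReal (π * r^2 + π * a * b + 4 * r * a * Ecomp (ecc a b)) := by
  have ha : 0 < a := hb.trans_le hab
  have hsub : Kset a b ⊆ Kset a b + closedBall (0 : E2) r :=
    subset_add_left _ (mem_closedBall_self hr)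
  have hE : 0 ≤ Ecomp (ecc a b) :=
    intervalIntegral.integral_nonneg (by positivity) fun _ _ => sqrt_nonneg _
  rw [← measure_inter_add_sdiff _ (isClosed_Kset a b).measurableSet,
    inter_eq_self_of_subset_right hsub, volume_Kset ha hb,
    volume_parallel_diff_Kset ha hb hr, setLIntegral_add_curvatureRadius hb hab hr,
    ← ENNReal.ofReal_add (by positivity) (by positivity)]
  congr 1
  ring
end
end

section
/- Let a > b > 0, r > 0, ε = √(a²−b²)/a, and p(φ) = √(a² cos²φ + b² sin²φ). Define F(φ) = 2r²φ + 2ab·arctan((b/a)tanφ) − 4ra·E(φ,ε) + raε² sin(2φ)/√(1−ε² sin²φ). Then for every φ ∈ (−π/2, π/2), F is differentiable at φ with F'(φ) = 2(p(φ) − r)·(a²b²/p(φ)³ − r), i.e. F'(φ) = 2(p(φ) − r)(p(φ) − r + p''(φ)). -/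
open Real Set

noncomputable section

/-- Support function of the ellipse with semi-axes `a`, `b`. -/
def psup (a b φ : ℝ) : ℝ := Real.sqrt (a^2 * Real.cos φ^2 + b^2 * Real.sin φ^2)

/-- The antiderivative `F(φ)` from the paper's Lemma 1. -/
def Ffun (a b r φ : ℝ) : ℝ :=
  2*r^2*φ + 2*a*b*Real.arctan ((b/a)*Real.tan φ) - 4*r*a*Einc (ecc a b) φ
    + r*a*(ecc a b)^2 * Real.sin (2*φ) / Real.sqrt (1 - (ecc a b)^2 * Real.sin φ^2)

lemma psup_pos {a b : ℝ} (ha : 0 < a) (hb : 0 < b) (φ : ℝ) : 0 < psup a b φ := by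
  refine Real.sqrt_pos.2 ?_
  rcases eq_or_ne (Real.cos φ) 0 with h | h
  · have hs : Real.sin φ ^ 2 = 1 := by
      have := Real.sin_sq_add_cos_sq φ
      rw [h] at this
      linarith
    rw [hs]
    positivity
  · positivity

lemma psup_sq (a b φ : ℝ) :
    psup a b φ ^ 2 = a^2 * Real.cos φ^2 + b^2 * Real.sin φ^2 :=
  Real.sq_sqrt (by positivity)

lemma continuous_psup (a b : ℝ) : Continuous (psup a b) := by
  unfold psup
  fun_prop

lemma hasDerivAt_psup {a b : ℝ} (ha : 0 < a) (hb : 0 < b) (φ : ℝ) :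
    HasDerivAt (psup a b) ((b^2 - a^2) * (Real.sin φ * Real.cos φ) / psup a b φ) φ := by
  have hp := psup_pos ha hb φ
  have h := ((((Real.hasDerivAt_cos φ).pow 2).const_mul (a^2)).add
    (((Real.hasDerivAt_sin φ).pow 2).const_mul (b^2))).sqrt (Real.sqrt_pos.1 hp).ne'
  refine h.congr_deriv ?_
  change _ / (2 * psup a b φ) = _
  field_simp
  push_cast
  ring

lemma hasDerivAt_deriv_psup {a b : ℝ} (ha : 0 < a) (hb : 0 < b) (φ : ℝ) :
    HasDerivAt (fun x => (b^2 - a^2) * (Real.sin x * Real.cos x) / psup a b x)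
      (a^2*b^2/(psup a b φ)^3 - psup a b φ) φ := by
  have hp := psup_pos ha hb φ
  have h := (((Real.hasDerivAt_sin φ).mul (Real.hasDerivAt_cos φ)).const_mul (b^2 - a^2)).div
    (hasDerivAt_psup ha hb φ) hp.ne'
  refine h.congr_deriv ?_
  have h4 : psup a b φ ^ 4 = (a^2 * Real.cos φ^2 + b^2 * Real.sin φ^2)^2 := by
    rw [← psup_sq]; ring
  have hc := Real.cos_sq' φ
  have hp2 := psup_sq a b φ
  rw [hc] at h4 hp2
  simp only [Pi.mul_apply]
  field_simp
  linear_combination h4 + (b^2 - a^2) * (1 - 2 * Real.sin φ^2) * hp2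
    + ((b^2 - a^2) * psup a b φ^2 - (b^2 - a^2)^2 * Real.sin φ^2) * hc

lemma ecc_sq {a b : ℝ} (hb : 0 < b) (hba : b < a) : ecc a b ^ 2 = (a^2 - b^2) / a^2 := by
  rw [ecc, div_pow, Real.sq_sqrt (by nlinarith)]

lemma sqrt_one_sub_ecc_sq_mul_sin_sq {a b : ℝ} (hb : 0 < b) (hba : b < a) (φ : ℝ) :
    Real.sqrt (1 - ecc a b ^ 2 * Real.sin φ^2) = psup a b φ / a := by
  have ha : 0 < a := hb.trans hba
  rw [Real.sqrt_eq_iff_mul_self_eq_of_pos (div_pos (psup_pos ha hb φ) ha), ecc_sq hb hba,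
    div_mul_div_comm, ← sq, psup_sq, Real.cos_sq']
  field_simp
  ring

lemma hasDerivAt_arctan_mul_tan {a b φ : ℝ} (ha : 0 < a) (hb : 0 < b) (hφ : Real.cos φ ≠ 0) :
    HasDerivAt (fun x => Real.arctan ((b/a) * Real.tan x)) (a*b/(psup a b φ)^2) φ := by
  refine ((Real.hasDerivAt_tan hφ).const_mul (b/a)).arctan.congr_deriv ?_
  rw [psup_sq, Real.tan_eq_sin_div_cos]
  field_simp

lemma Ffun_eq {a b : ℝ} (hb : 0 < b) (hba : b < a) (r : ℝ) :
    Ffun a b r = fun φ => 2*r^2*φ + 2*a*b*Real.arctan ((b/a)*Real.tan φ)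
      - 4*r*(∫ θ in (0:ℝ)..φ, psup a b θ)
      - 2*r*((b^2 - a^2) * (Real.sin φ * Real.cos φ) / psup a b φ) := by
  have ha : 0 < a := hb.trans hba
  funext φ
  have hp := psup_pos ha hb φ
  simp only [Ffun, Einc, sqrt_one_sub_ecc_sq_mul_sin_sq hb hba, Real.sin_two_mul,
    intervalIntegral.integral_div]
  rw [ecc_sq hb hba]
  field_simp
  ring

/-- On `(−π/2, π/2)`, `F` is differentiable with derivative
`F'(φ) = 2(p(φ) − r)(a²b²/p(φ)³ − r) = 2(p(φ) − r)(p(φ) − r + p''(φ))`. -/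
theorem Ffun_hasDerivAt (a b r : ℝ) (hb : 0 < b) (hba : b < a) (hr : 0 < r) :
    ∀ φ ∈ Ioo (-(π/2)) (π/2),
      HasDerivAt (Ffun a b r) (2*(psup a b φ - r)*(a^2*b^2/(psup a b φ)^3 - r)) φ ∧
      2*(psup a b φ - r)*(a^2*b^2/(psup a b φ)^3 - r)
        = 2*(psup a b φ - r)*(psup a b φ - r + deriv (deriv (psup a b)) φ) := by
  intro φ hφ
  have ha : 0 < a := hb.trans hba
  have hp := psup_pos ha hb φ
  have hd := hasDerivAt_deriv_psup ha hb φ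
  constructor
  · rw [Ffun_eq hb hba]
    have hint : HasDerivAt (fun x => ∫ θ in (0:ℝ)..x, psup a b θ) (psup a b φ) φ :=
      intervalIntegral.integral_hasDerivAt_right ((continuous_psup a b).intervalIntegrable _ _)
        ((continuous_psup a b).stronglyMeasurableAtFilter _ _) (continuous_psup a b).continuousAt
    refine (((((hasDerivAt_id φ).const_mul (2*r^2)).add
      ((hasDerivAt_arctan_mul_tan ha hb (Real.cos_pos_of_mem_Ioo hφ).ne').const_mul
        (2*a*b))).sub (hint.const_mul (4*r))).sub (hd.const_mul (2*r))).congr_deriv ?_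
    field_simp
    ring
  · rw [show deriv (psup a b) = _ from funext fun x => (hasDerivAt_psup ha hb x).deriv, hd.deriv]
    ring
end
end
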